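/- Let q, t ∈ (0,1), τ := log_q t, ζ₊ > 0, ζ₋ < 0, N ∈ ℤ_{≥1}. Suppose c = conj(d) ∈ ℂ∖ℝ, a = conj(b) ∈ ℂ∖ℝ, and ab < cd · q^{2τ(N−1)+1} (both products being positive reals). Then M̃_N(X; q,t; a,b,c,d) is a strictly positive real for every X ∈ Ω_N, the sum Z_N := Σ_{X∈Ω_N} M̃_N(X; q,t; a,b,c,d) is finite and strictly positive, and hence X ↦ M̃_N(X; q,t; a,b,c,d)/Z_N defines a probability distribution on Ω_N with strictly positive weights. -/

import Mathlib

/-- The infinite q-Pochhammer symbol `(u; q)_∞` (complex version). -/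
noncomputable def qPochC (q : ℝ) (u : ℂ) : ℂ := ∏' n : ℕ, (1 - u * (q : ℂ) ^ n)

/-- The infinite q-Pochhammer symbol `(u; q)_∞` (real version). -/
noncomputable def qPochR (q u : ℝ) : ℝ := ∏' n : ℕ, (1 - u * q ^ n)

/-- The weight function `W(x; q; a,b,c,d) = (1-q)|x| (ax;q)_∞(bx;q)_∞ / ((cx;q)_∞(dx;q)_∞)`. -/
noncomputable def Wc (q : ℝ) (a b c d : ℂ) (x : ℝ) : ℂ :=
  (((1 - q) * |x| : ℝ) : ℂ) * (qPochC q (a * x) * qPochC q (b * x)) /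
    (qPochC q (c * x) * qPochC q (d * x))

/-- The theta function `θ_q(v) = (v;q)_∞ (q v⁻¹;q)_∞`. -/
noncomputable def thetaQ (q v : ℝ) : ℝ := qPochR q v * qPochR q (q * v⁻¹)

/-- `ψ_τ(u) = (-u)^{2τ-1} θ_q(tu)/θ_q(t u⁻¹)` with `τ = log_q t`. -/
noncomputable def psiQ (q t u : ℝ) : ℝ :=
  (-u) ^ (2 * Real.logb q t - 1) * thetaQ q (t * u) / thetaQ q (t * u⁻¹)

/-- A (finite or countably infinite) particle configuration: a countable set of nonzero
reals, whose points can be enumerated from the outside toward 0 on each side, whose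
outermost positive (resp. negative) point lies on `ζ₊ q^ℤ` (resp. `ζ₋ q^ℤ`), and in which
any two consecutive points of the same sign have ratio in `t q^{ℤ≥0}`. -/
def IsConfig (q t ζp ζm : ℝ) (X : Set ℝ) : Prop :=
  X.Countable ∧ (0 : ℝ) ∉ X ∧
  (∀ x ∈ X, 0 < x → {y ∈ X | x < y}.Finite) ∧
  (∀ x ∈ X, x < 0 → {y ∈ X | y < x}.Finite) ∧
  (∀ x ∈ X, 0 < x → (∀ y ∈ X, 0 < y → y ≤ x) → ∃ n : ℤ, x = ζp * q ^ n) ∧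
  (∀ x ∈ X, x < 0 → (∀ y ∈ X, y < 0 → x ≤ y) → ∃ n : ℤ, x = ζm * q ^ n) ∧
  (∀ x ∈ X, ∀ y ∈ X, 0 < y → y < x → (∀ z ∈ X, z ≤ y ∨ x ≤ z) → ∃ k : ℕ, y = x * t * q ^ k) ∧
  (∀ x ∈ X, ∀ y ∈ X, y < x → x < 0 → (∀ z ∈ X, z ≤ y ∨ x ≤ z) → ∃ k : ℕ, x = y * t * q ^ k)

/-- The set `Ω_N` of N-particle configurations, realized as finsets of reals. -/
def OmegaN (q t ζp ζm : ℝ) (N : ℕ) : Set (Finset ℝ) :=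
  {X | X.card = N ∧ IsConfig q t ζp ζm ↑X}

/-- The (q,t)-interaction `V_{q,t}(X)`. -/
noncomputable def Vqt (q t : ℝ) (X : Finset ℝ) : ℝ :=
  (∏ x ∈ X, ∏ y ∈ X, if y < x then (x - y) else 1) *
  (∏ x ∈ X, ∏ y ∈ X, if 0 < x ∧ y < x then
      x ^ (2 * Real.logb q t - 1) * qPochR q (q * t⁻¹ * y * x⁻¹) / qPochR q (t * y * x⁻¹)
    else 1) *
  (∏ x ∈ X, ∏ y ∈ X, if x < 0 ∧ y < x then
      |y| ^ (2 * Real.logb q t - 1) * qPochR q (q * t⁻¹ * x * y⁻¹) / qPochR q (t * x * y⁻¹)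
    else 1)

/-- The constant `C_N(k) = ∏_{1≤i<j≤N, i≤k} ψ_τ(ζ₋ζ₊⁻¹ t^{N-i-j+1})`. -/
noncomputable def CNconst (q t ζp ζm : ℝ) (N k : ℕ) : ℝ :=
  ∏ i ∈ Finset.Icc 1 N, ∏ j ∈ Finset.Icc 1 N,
    if i < j ∧ i ≤ k then psiQ q t (ζm * ζp⁻¹ * t ^ ((N : ℤ) - (i : ℤ) - (j : ℤ) + 1)) else 1

/-- The unnormalized N-particle weight
`M̃_N(X) = C_N(|X⁺|) V_{q,t}(X) ∏_{x∈X} W(x; q; a,b,c,d)`. -/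
noncomputable def Mtilde (q t ζp ζm : ℝ) (N : ℕ) (a b c d : ℂ) (X : Finset ℝ) : ℂ :=
  ((CNconst q t ζp ζm N (X.filter (fun x => 0 < x)).card * Vqt q t X : ℝ) : ℂ) *
    ∏ x ∈ X, Wc q a b c d x

open Filter Topology

section QPochhammer

variable {q : ℝ}

lemma summable_norm_neg_mul_pow (hq0 : 0 < q) (hq1 : q < 1) (u : ℝ) :
    Summable fun n : ℕ => ‖-(u * q ^ n)‖ := by
  simpa only [norm_neg, norm_mul, norm_pow] using (summable_geometric_of_lt_one (norm_nonneg q)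
    (by rwa [Real.norm_of_nonneg hq0.le])).mul_left ‖u‖

lemma summable_norm_neg_mul_pow_complex (hq0 : 0 < q) (hq1 : q < 1) (u : ℂ) :
    Summable fun n : ℕ => ‖-(u * (q : ℂ) ^ n)‖ := by
  simpa only [norm_neg, norm_mul, norm_pow, Complex.norm_real] using
    (summable_geometric_of_lt_one (norm_nonneg q)
      (by rwa [Real.norm_of_nonneg hq0.le])).mul_left ‖u‖

lemma qPochR_multipliable (hq0 : 0 < q) (hq1 : q < 1) (u : ℝ) :
    Multipliable fun n : ℕ => 1 - u * q ^ n := by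
  simpa only [sub_eq_add_neg] using
    multipliable_one_add_of_summable (summable_norm_neg_mul_pow hq0 hq1 u)

lemma qPochC_multipliable (hq0 : 0 < q) (hq1 : q < 1) (u : ℂ) :
    Multipliable fun n : ℕ => 1 - u * (q : ℂ) ^ n := by
  simpa only [sub_eq_add_neg] using
    multipliable_one_add_of_summable (summable_norm_neg_mul_pow_complex hq0 hq1 u)

lemma qPochR_tendsto (hq0 : 0 < q) (hq1 : q < 1) (u : ℝ) :
    Tendsto (fun n => ∏ i ∈ Finset.range n, (1 - u * q ^ i)) atTop (𝓝 (qPochR q u)) :=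
  (qPochR_multipliable hq0 hq1 u).tendsto_prod_tprod_nat

lemma qPochC_tendsto (hq0 : 0 < q) (hq1 : q < 1) (u : ℂ) :
    Tendsto (fun n => ∏ i ∈ Finset.range n, (1 - u * (q : ℂ) ^ i)) atTop (𝓝 (qPochC q u)) :=
  (qPochC_multipliable hq0 hq1 u).tendsto_prod_tprod_nat

lemma qPochR_eq_mul (hq0 : 0 < q) (hq1 : q < 1) (u : ℝ) :
    qPochR q u = (1 - u) * qPochR q (u * q) := by
  refine tendsto_nhds_unique ((qPochR_tendsto hq0 hq1 u).comp (tendsto_add_atTop_nat 1))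
    (((qPochR_tendsto hq0 hq1 (u * q)).const_mul (1 - u)).congr fun n => ?_)
  simp only [Function.comp_apply, Finset.prod_range_succ', mul_comm (1 - u), pow_succ', mul_assoc,
    pow_zero, mul_one]

lemma qPochC_eq_mul (hq0 : 0 < q) (hq1 : q < 1) (u : ℂ) :
    qPochC q u = (1 - u) * qPochC q (u * q) := by
  refine tendsto_nhds_unique ((qPochC_tendsto hq0 hq1 u).comp (tendsto_add_atTop_nat 1))
    (((qPochC_tendsto hq0 hq1 (u * q)).const_mul (1 - u)).congr fun n => ?_)
  simp only [Function.comp_apply, Finset.prod_range_succ', mul_comm (1 - u), pow_succ', mul_assoc,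
    pow_zero, mul_one]

lemma one_sub_mul_pow_pos (hq0 : 0 < q) (hq1 : q < 1) {u : ℝ} (hu : u < 1) (n : ℕ) :
    0 < 1 - u * q ^ n := by
  have h1 : q ^ n ≤ 1 := pow_le_one₀ hq0.le hq1.le
  have h0 : 0 < q ^ n := pow_pos hq0 n
  nlinarith

lemma qPochR_pos (hq0 : 0 < q) (hq1 : q < 1) {u : ℝ} (hu : u < 1) : 0 < qPochR q u := by
  refine lt_of_le_of_ne (ge_of_tendsto' (qPochR_tendsto hq0 hq1 u) fun n =>
    Finset.prod_nonneg fun i _ => (one_sub_mul_pow_pos hq0 hq1 hu i).le) (Ne.symm ?_)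
  have := tprod_one_add_ne_zero_of_summable (f := fun n : ℕ => -(u * q ^ n))
    (fun i => by rw [← sub_eq_add_neg]; exact (one_sub_mul_pow_pos hq0 hq1 hu i).ne')
    (summable_norm_neg_mul_pow hq0 hq1 u)
  simpa only [← sub_eq_add_neg, qPochR] using this

lemma qPochR_anti (hq0 : 0 < q) (hq1 : q < 1) {u v : ℝ} (huv : u ≤ v) (hv : v < 1) :
    qPochR q v ≤ qPochR q u := by
  refine le_of_tendsto_of_tendsto' (qPochR_tendsto hq0 hq1 v) (qPochR_tendsto hq0 hq1 u)
    fun n => Finset.prod_le_prod (fun i _ => (one_sub_mul_pow_pos hq0 hq1 hv i).le) fun i _ => ?_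
  gcongr

lemma qPochR_zero : qPochR q 0 = 1 := by simp [qPochR]

lemma prod_le_qPochR (hq0 : 0 < q) (hq1 : q < 1) {u : ℝ} (hu : u ≤ 0) (m : ℕ) :
    ∏ i ∈ Finset.range m, (1 - u * q ^ i) ≤ qPochR q u := by
  refine ge_of_tendsto (qPochR_tendsto hq0 hq1 u) ?_
  filter_upwards [eventually_ge_atTop m] with n hn
  refine Finset.prod_le_prod_of_subset_of_one_le (by simpa using hn)
    (fun i _ => (one_sub_mul_pow_pos hq0 hq1 (by linarith) i).le) fun i _ _ => ?_
  have := pow_pos hq0 i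
  nlinarith

lemma qPochC_ne_zero (hq0 : 0 < q) (hq1 : q < 1) {u : ℂ} (hu : u.im ≠ 0) : qPochC q u ≠ 0 := by
  have := tprod_one_add_ne_zero_of_summable (f := fun n : ℕ => -(u * (q : ℂ) ^ n))
    (fun i hi => by
      have := congrArg Complex.im hi
      rw [← Complex.ofReal_pow, Complex.add_im, Complex.neg_im, Complex.im_mul_ofReal] at this
      simp [hu, hq0.ne'] at this)
    (summable_norm_neg_mul_pow_complex hq0 hq1 u)
  simpa only [← sub_eq_add_neg, qPochC] using this

lemma qPochC_conj (hq0 : 0 < q) (hq1 : q < 1) (u : ℂ) :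
    qPochC q ((starRingEnd ℂ) u) = (starRingEnd ℂ) (qPochC q u) := by
  refine tendsto_nhds_unique (qPochC_tendsto hq0 hq1 _)
    (((Complex.continuous_conj.tendsto _).comp (qPochC_tendsto hq0 hq1 u)).congr fun n => ?_)
  simp [map_prod]

/-- A function whose growth under the dilation `v ↦ v / q` is controlled by `1 + D / v` is bounded
on `[1, ∞)` by its values on the fundamental interval. -/
lemma le_mul_qPochR_of_dilation (hq0 : 0 < q) (hq1 : q < 1) {D M : ℝ} (hD : 0 ≤ D) {G : ℝ → ℝ}
    (hG : ∀ v, 1 ≤ v → 0 ≤ G v) (hstep : ∀ v, 1 ≤ v → G (v / q) ≤ G v * (1 + D / v))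
    (hM : ∀ v, 1 ≤ v → v ≤ 1 / q → G v ≤ M) (v : ℝ) (hv : 1 ≤ v) :
    G v ≤ M * qPochR q (-D) := by
  have hq' : 1 < 1 / q := by rw [lt_div_iff₀ hq0]; linarith
  have hM0 : 0 ≤ M := (hG 1 le_rfl).trans (hM 1 le_rfl hq'.le)
  have key : ∀ m : ℕ, ∀ w, 1 ≤ w → w ≤ 1 / q →
      G (w / q ^ m) ≤ M * ∏ i ∈ Finset.range m, (1 - -D * q ^ i) := by
    intro m w hw1 hw2
    induction m with
    | zero => simpa using hM w hw1 hw2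
    | succ m ih =>
      have hm := pow_pos hq0 m
      have h1 : 1 ≤ w / q ^ m := by
        rw [le_div_iff₀ hm, one_mul]
        exact (pow_le_one₀ hq0.le hq1.le).trans hw1
      rw [pow_succ, ← div_div, Finset.prod_range_succ, ← mul_assoc]
      refine (hstep _ h1).trans (mul_le_mul ih ?_ (by positivity) ((hG _ h1).trans ih))
      rw [div_div_eq_mul_div, neg_mul, sub_neg_eq_add]
      gcongr
      exact div_le_self (by positivity) hw1
  obtain ⟨m, hm1, hm2⟩ := exists_nat_pow_near hv hq'
  have hm := pow_pos hq0 m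
  have := key m (v * q ^ m) ?_ ?_
  · rw [mul_div_cancel_right₀ _ hm.ne'] at this
    exact this.trans (mul_le_mul_of_nonneg_left (prod_le_qPochR hq0 hq1 (by linarith) m) hM0)
  · rwa [one_div, inv_pow, inv_le_iff_one_le_mul₀ hm] at hm1
  · rw [one_div, pow_succ, inv_pow, ← div_eq_inv_mul, lt_div_iff₀ hm] at hm2
    simpa using hm2.le

/-- Power growth of a quotient of two q-Pochhammer symbols along the negative axis. -/
lemma exists_qPochR_ratio_le (hq0 : 0 < q) (hq1 : q < 1) {α β s : ℝ} (hα : 0 < α) (hβ : 0 < β)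
    (hs : α / β = q ^ s) :
    ∃ K : ℝ, 0 < K ∧ ∀ v, 1 ≤ v → qPochR q (-(α * v)) / qPochR q (-(β * v)) ≤ K * v ^ (-s) := by
  have hpos : ∀ {γ v : ℝ}, 0 < γ → 0 < v → 0 < qPochR q (-(γ * v)) := fun hγ hv =>
    qPochR_pos hq0 hq1 (by have := mul_pos hγ hv; linarith)
  set G : ℝ → ℝ := fun v => qPochR q (-(α * v)) / qPochR q (-(β * v)) * v ^ s with hGdef
  set M : ℝ := qPochR q (-(α * (1 / q))) * (1 / q) ^ |s|
  have hM0 : 0 < M := mul_pos (hpos hα (by positivity)) (by positivity)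
  have hD : 0 < q / α := by positivity
  have hb := le_mul_qPochR_of_dilation hq0 hq1 (G := G) (M := M) hD.le ?_ ?_ ?_
  · refine ⟨M * qPochR q (-(q / α)), mul_pos hM0 (qPochR_pos hq0 hq1 (by linarith)),
      fun v hv => ?_⟩
    have h0 : 0 < v := by linarith
    rw [Real.rpow_neg h0.le, ← div_eq_mul_inv, le_div_iff₀ (Real.rpow_pos_of_pos h0 s)]
    exact hb v hv
  · intro v hv
    have h0 : 0 < v := by linarith
    have := hpos hα h0
    have := hpos hβ h0
    positivity
  · intro v hv
    have h0 : 0 < v := by linarith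
    have e1 := hpos hα h0
    have e2 := hpos hβ h0
    have r : ∀ γ : ℝ, qPochR q (-(γ * (v / q))) = (1 + γ * (v / q)) * qPochR q (-(γ * v)) := by
      intro γ
      rw [qPochR_eq_mul hq0 hq1, sub_neg_eq_add]
      congr 2
      field_simp
    have hfac : G (v / q) = G v * ((1 + q / α / v) / (1 + q / β / v)) := by
      simp only [hGdef]
      rw [r, r, Real.div_rpow h0.le hq0.le, ← hs]
      field_simp
      ring
    rw [hfac]
    refine mul_le_mul_of_nonneg_left (div_le_self (by positivity) ?_) (by positivity)
    have : 0 < q / β / v := by positivity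
    linarith
  · intro v hv1 hv2
    have h0 : 0 < v := by linarith
    have e1 := hpos hα h0
    refine mul_le_mul ?_ ?_ (by positivity) (hpos hα (by positivity)).le
    · refine (div_le_self e1.le ?_).trans (qPochR_anti hq0 hq1 ?_ ?_)
      · rw [← qPochR_zero (q := q)]
        exact qPochR_anti hq0 hq1 (by have := mul_pos hβ h0; linarith) (by norm_num)
      · gcongr
      · have := mul_pos hα h0; linarith
    · exact (Real.rpow_le_rpow_of_exponent_le hv1 (le_abs_self s)).trans
        (Real.rpow_le_rpow h0.le hv2 (abs_nonneg s))

end QPochhammer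

section Interaction

variable {q t : ℝ}

/-- The full interaction between a particle at `x > 0` and a particle at `y < x`. -/
noncomputable def pairCore (q t x y : ℝ) : ℝ :=
  (x - y) * (x ^ (2 * Real.logb q t - 1) * qPochR q (q * t⁻¹ * y * x⁻¹) / qPochR q (t * y * x⁻¹))

lemma pairCore_same_sign (hq0 : 0 < q) (hq1 : q < 1) (ht0 : 0 < t) (ht1 : t < 1) {x : ℝ}
    (hx : 0 < x) (m k : ℕ) :
    0 < pairCore q t x (x * t ^ (m + 1) * q ^ k) ∧
      pairCore q t x (x * t ^ (m + 1) * q ^ k) ≤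
        (qPochR q t)⁻¹ * x ^ (2 * Real.logb q t) := by
  set u : ℝ := t ^ (m + 1) * q ^ k with hu
  have hu0 : 0 < u := by positivity
  have hqk : q ^ k ≤ 1 := pow_le_one₀ hq0.le hq1.le
  have htm : t ^ m ≤ 1 := pow_le_one₀ ht0.le ht1.le
  have hut : t⁻¹ * u ≤ 1 := by
    rw [hu, pow_succ', mul_assoc, inv_mul_cancel_left₀ ht0.ne']
    exact mul_le_one₀ htm (by positivity) hqk
  have hu1 : u < 1 := by
    rw [inv_mul_le_iff₀ ht0] at hut; linarith
  have e : x * t ^ (m + 1) * q ^ k = x * u := by rw [hu, mul_assoc]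
  have e1 : q * t⁻¹ * (x * u) * x⁻¹ = q * (t⁻¹ * u) := by field_simp
  have e2 : t * (x * u) * x⁻¹ = t * u := by field_simp
  have hnum1 : q * (t⁻¹ * u) < 1 := (mul_le_of_le_one_right hq0.le hut).trans_lt hq1
  have htu : t * u < t := mul_lt_of_lt_one_right ht0 hu1
  have p1 := qPochR_pos hq0 hq1 hnum1
  have p2 := qPochR_pos hq0 hq1 (htu.trans ht1)
  have p3 := qPochR_pos hq0 hq1 ht1
  have hn : qPochR q (q * (t⁻¹ * u)) ≤ 1 := by
    rw [← qPochR_zero (q := q)]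
    exact qPochR_anti hq0 hq1 (by positivity) hnum1
  have hd : qPochR q t ≤ qPochR q (t * u) := qPochR_anti hq0 hq1 htu.le ht1
  have hxp : 0 < x ^ (2 * Real.logb q t - 1) := Real.rpow_pos_of_pos hx _
  have hxu : 0 < x - x * u := by nlinarith
  rw [e, pairCore, e1, e2]
  refine ⟨by positivity, ?_⟩
  have hpow : x ^ (2 * Real.logb q t) = x * x ^ (2 * Real.logb q t - 1) := by
    rw [Real.rpow_sub_one hx.ne']; field_simp
  calc (x - x * u) * (x ^ (2 * Real.logb q t - 1) * qPochR q (q * (t⁻¹ * u)) / qPochR q (t * u))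
      ≤ x * (x ^ (2 * Real.logb q t - 1) * 1 / qPochR q t) := by
        gcongr
        have := mul_pos hx hu0
        linarith
    _ = _ := by rw [hpow]; field_simp

lemma pairCore_opposite_sign_pos (hq0 : 0 < q) (hq1 : q < 1) (ht0 : 0 < t) {x y : ℝ}
    (hx : 0 < x) (hy : y < 0) : 0 < pairCore q t x y := by
  have e : ∀ γ : ℝ, 0 < γ → 0 < qPochR q (γ * y * x⁻¹) := fun γ hγ =>
    qPochR_pos hq0 hq1 (by
      have := mul_pos hγ (mul_pos (neg_pos.2 hy) (inv_pos.2 hx)); linarith)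
  have e1 := e (q * t⁻¹) (by positivity)
  have e2 := e t ht0
  have : 0 < x - y := by linarith
  rw [pairCore]
  positivity

lemma exists_pairCore_opposite_sign_le (hq0 : 0 < q) (hq1 : q < 1) (ht0 : 0 < t) :
    ∃ K : ℝ, 0 < K ∧ ∀ x y : ℝ, 0 < x → y < 0 →
      pairCore q t x y ≤ K * max x (-y) ^ (2 * Real.logb q t) := by
  have hα : 0 < q * t⁻¹ := by positivity
  have hs : q * t⁻¹ / t = q ^ (1 - 2 * Real.logb q t) := by
    rw [Real.rpow_sub hq0, Real.rpow_one, two_mul, Real.rpow_add hq0,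
      Real.rpow_logb hq0 hq1.ne ht0]
    field_simp
  obtain ⟨K, hK, hKb⟩ := exists_qPochR_ratio_le hq0 hq1 hα ht0 hs
  set A := qPochR q (-(q * t⁻¹))
  have hA : 0 < A := qPochR_pos hq0 hq1 (by linarith)
  have hpow : ∀ x : ℝ, 0 < x →
      x ^ (2 * Real.logb q t) = x * x ^ (2 * Real.logb q t - 1) := fun x hx => by
    rw [Real.rpow_sub_one hx.ne']; field_simp
  refine ⟨2 * (K + A), by positivity, fun x y hx hy => ?_⟩
  obtain ⟨z, rfl⟩ : ∃ z, y = -z := ⟨-y, by simp⟩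
  have hz : 0 < z := by linarith
  have hv : 0 < z / x := by positivity
  have e : ∀ γ : ℝ, γ * -z * x⁻¹ = -(γ * (z / x)) := fun γ => by ring
  have hden : ∀ γ : ℝ, 0 < γ → 0 < qPochR q (-(γ * (z / x))) := fun γ hγ =>
    qPochR_pos hq0 hq1 (by have := mul_pos hγ hv; linarith)
  have hnum' := hden _ hα
  have hden' := hden _ ht0
  rw [pairCore, e, e, sub_neg_eq_add, neg_neg, mul_div_assoc]
  rcases le_total z x with hzx | hzx
  · rw [max_eq_left hzx, hpow x hx]
    have hr : qPochR q (-(q * t⁻¹ * (z / x))) / qPochR q (-(t * (z / x))) ≤ K + A := by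
      have hv1 : z / x ≤ 1 := (div_le_one hx).2 hzx
      refine (div_le_self (hden _ hα).le ?_).trans ((qPochR_anti hq0 hq1 ?_ ?_).trans
        (le_add_of_nonneg_left hK.le))
      · rw [← qPochR_zero (q := q)]
        exact qPochR_anti hq0 hq1 (by have := mul_pos ht0 hv; linarith) (by norm_num)
      · exact neg_le_neg (mul_le_of_le_one_right hα.le hv1)
      · have := mul_pos hα hv; linarith
    calc (x + z) * (x ^ (2 * Real.logb q t - 1) * _)
        ≤ (x + x) * (x ^ (2 * Real.logb q t - 1) * (K + A)) := by gcongr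
      _ = _ := by ring
  · rw [max_eq_right hzx, hpow z hz]
    have hr := hKb (z / x) ((one_le_div hx).2 hzx)
    rw [neg_sub, Real.div_rpow hz.le hx.le] at hr
    have hxp : 0 < x ^ (2 * Real.logb q t - 1) := Real.rpow_pos_of_pos hx _
    calc (x + z) * (x ^ (2 * Real.logb q t - 1) * _)
        ≤ (z + z) * (x ^ (2 * Real.logb q t - 1) *
          (K * (z ^ (2 * Real.logb q t - 1) / x ^ (2 * Real.logb q t - 1)))) := by
          gcongr
      _ = 2 * K * (z * z ^ (2 * Real.logb q t - 1)) := by field_simp; ring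
      _ ≤ _ := by gcongr; linarith

/-- The factor of `Vqt` attached to the ordered pair `(x, y)`. -/
noncomputable def pairTerm (q t x y : ℝ) : ℝ :=
  (if y < x then (x - y) else 1) *
  (if 0 < x ∧ y < x then
      x ^ (2 * Real.logb q t - 1) * qPochR q (q * t⁻¹ * y * x⁻¹) / qPochR q (t * y * x⁻¹)
    else 1) *
  (if x < 0 ∧ y < x then
      |y| ^ (2 * Real.logb q t - 1) * qPochR q (q * t⁻¹ * x * y⁻¹) / qPochR q (t * x * y⁻¹)
    else 1)

lemma Vqt_eq_prod_pairTerm (X : Finset ℝ) :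
    Vqt q t X = ∏ x ∈ X, ∏ y ∈ X, pairTerm q t x y := by
  simp only [Vqt, pairTerm, Finset.prod_mul_distrib]

lemma pairTerm_of_not_lt {x y : ℝ} (h : ¬ y < x) : pairTerm q t x y = 1 := by
  simp [pairTerm, h]

lemma pairTerm_of_pos {x y : ℝ} (hx : 0 < x) (h : y < x) :
    pairTerm q t x y = pairCore q t x y := by
  simp [pairTerm, pairCore, h, hx, not_lt.2 hx.le]

lemma pairTerm_of_neg {x y : ℝ} (hx : x < 0) (h : y < x) :
    pairTerm q t x y = pairCore q t (-y) (-x) := by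
  have e : ∀ γ : ℝ, γ * -x * (-y)⁻¹ = γ * x * y⁻¹ := fun γ => by rw [inv_neg]; ring
  simp only [pairTerm, pairCore, h, hx, not_lt.2 hx.le, abs_of_neg (h.trans hx), e, if_true,
    and_self, false_and, if_false, mul_one]
  ring

/-- The part of the configuration condition that the interaction sees: points of the same sign
have ratio in `t^{m+1} q^k`. -/
def RatioCond (q t : ℝ) (X : Finset ℝ) : Prop :=
  (∀ x ∈ X, ∀ y ∈ X, 0 < y → y < x → ∃ m k : ℕ, y = x * t ^ (m + 1) * q ^ k) ∧
  (∀ x ∈ X, ∀ y ∈ X, y < x → x < 0 → ∃ m k : ℕ, x = y * t ^ (m + 1) * q ^ k)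

lemma exists_pairTerm_bounds (hq0 : 0 < q) (hq1 : q < 1) (ht0 : 0 < t) (ht1 : t < 1) :
    ∃ K : ℝ, 1 ≤ K ∧ ∀ X : Finset ℝ, (0 : ℝ) ∉ X → RatioCond q t X → ∀ x ∈ X, ∀ y ∈ X,
      0 < pairTerm q t x y ∧ pairTerm q t x y ≤ K * if y < x then
        (1 + |x|) ^ (2 * Real.logb q t) * (1 + |y|) ^ (2 * Real.logb q t) else 1 := by
  obtain ⟨K, hK, hKb⟩ := exists_pairCore_opposite_sign_le hq0 hq1 ht0
  have hτ := Real.logb_pos_of_base_lt_one hq0 hq1 ht0 ht1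
  set s := 2 * Real.logb q t with hs
  have hs0 : 0 ≤ s := by positivity
  have hP : 0 < (qPochR q t)⁻¹ := inv_pos.2 (qPochR_pos hq0 hq1 ht1)
  have one_le : ∀ x : ℝ, 1 ≤ (1 + |x|) ^ s := fun x =>
    Real.one_le_rpow (by linarith [abs_nonneg x]) hs0
  have abs_le : ∀ x : ℝ, |x| ^ s ≤ (1 + |x|) ^ s := fun x => by gcongr; linarith
  refine ⟨1 + K + (qPochR q t)⁻¹, by linarith, fun X h0 hX x hx y hy => ?_⟩
  have hx0 : x ≠ 0 := fun e => h0 (e ▸ hx)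
  have hy0 : y ≠ 0 := fun e => h0 (e ▸ hy)
  by_cases hyx : y < x
  · rw [if_pos hyx]
    have bound : ∀ z : ℝ, z ≤ |x| ∨ z ≤ |y| → 0 ≤ z →
        z ^ s ≤ (1 + |x|) ^ s * (1 + |y|) ^ s := by
      rintro z (hz | hz) hz0
      · exact ((Real.rpow_le_rpow hz0 hz hs0).trans (abs_le x)).trans
          (le_mul_of_one_le_right (by positivity) (one_le y))
      · exact ((Real.rpow_le_rpow hz0 hz hs0).trans (abs_le y)).trans
          (le_mul_of_one_le_left (by positivity) (one_le x))
    rcases lt_or_gt_of_ne hx0 with hxn | hxp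
    · rw [pairTerm_of_neg hxn hyx]
      obtain ⟨m, k, hmk⟩ := hX.2 x hx y hy hyx hxn
      have e : -x = -y * t ^ (m + 1) * q ^ k := by rw [hmk]; ring
      obtain ⟨h1, h2⟩ := pairCore_same_sign hq0 hq1 ht0 ht1 (x := -y) (by linarith) m k
      rw [e]
      refine ⟨h1, h2.trans (mul_le_mul (by linarith) ?_ ?_ (by linarith))⟩
      · exact bound _ (Or.inr (neg_le_abs y)) (by linarith)
      · exact Real.rpow_nonneg (by linarith) _
    · rw [pairTerm_of_pos hxp hyx]
      rcases lt_or_gt_of_ne hy0 with hyn | hyp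
      · refine ⟨pairCore_opposite_sign_pos hq0 hq1 ht0 hxp hyn, (hKb x y hxp hyn).trans
          (mul_le_mul (by linarith) ?_ ?_ (by linarith))⟩
        · refine bound _ ?_ (hxp.le.trans (le_max_left _ _))
          rcases le_total x (-y) with h | h
          · rw [max_eq_right h]; exact Or.inr (neg_le_abs y)
          · rw [max_eq_left h]; exact Or.inl (le_abs_self x)
        · exact Real.rpow_nonneg (hxp.le.trans (le_max_left _ _)) _
      · obtain ⟨m, k, hmk⟩ := hX.1 x hx y hy hyp hyx
        obtain ⟨h1, h2⟩ := pairCore_same_sign hq0 hq1 ht0 ht1 hxp m k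
        rw [← hmk] at h1 h2
        refine ⟨h1, h2.trans (mul_le_mul (by linarith) ?_ ?_ (by linarith))⟩
        · exact bound _ (Or.inl (le_abs_self x)) hxp.le
        · exact Real.rpow_nonneg hxp.le _
  · rw [pairTerm_of_not_lt hyx, if_neg hyx]
    exact ⟨one_pos, by linarith⟩

lemma prod_prod_ite_lt_mul (X : Finset ℝ) (A : ℝ → ℝ) :
    ∏ x ∈ X, ∏ y ∈ X, (if y < x then A x * A y else 1) = ∏ x ∈ X, A x ^ (X.card - 1) := by
  have e : ∀ x y : ℝ, (if y < x then A x * A y else 1) =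
      (if y < x then A x else 1) * (if y < x then A y else 1) := fun x y => by
    split_ifs <;> simp
  simp only [e, Finset.prod_mul_distrib]
  rw [Finset.prod_comm (f := fun x y => if y < x then A y else 1), ← Finset.prod_mul_distrib]
  refine Finset.prod_congr rfl fun x hx => ?_
  rw [← Finset.prod_mul_distrib, ← Finset.card_erase_of_mem hx, ← Finset.prod_const,
    ← Finset.mul_prod_erase X _ hx]
  simp only [lt_irrefl, if_false, one_mul]
  refine Finset.prod_congr rfl fun y hy => ?_
  rcases lt_or_gt_of_ne (Finset.ne_of_mem_erase hy) with h | h <;> simp [h, not_lt.2 h.le]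

lemma exists_Vqt_bounds (hq0 : 0 < q) (hq1 : q < 1) (ht0 : 0 < t) (ht1 : t < 1) (N : ℕ) :
    ∃ K : ℝ, 0 < K ∧ ∀ X : Finset ℝ, X.card = N → (0 : ℝ) ∉ X → RatioCond q t X →
      0 < Vqt q t X ∧
        Vqt q t X ≤ K * ∏ x ∈ X, ((1 + |x|) ^ (2 * Real.logb q t)) ^ (N - 1) := by
  obtain ⟨K, hK, hb⟩ := exists_pairTerm_bounds hq0 hq1 ht0 ht1
  refine ⟨(K ^ N) ^ N, by positivity, fun X hN h0 hX => ?_⟩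
  rw [Vqt_eq_prod_pairTerm]
  refine ⟨Finset.prod_pos fun x hx => Finset.prod_pos fun y hy => (hb X h0 hX x hx y hy).1, ?_⟩
  calc _ ≤ ∏ x ∈ X, ∏ y ∈ X, K * (if y < x then
        (1 + |x|) ^ (2 * Real.logb q t) * (1 + |y|) ^ (2 * Real.logb q t) else 1) :=
        Finset.prod_le_prod
          (fun x hx => Finset.prod_nonneg fun y hy => (hb X h0 hX x hx y hy).1.le)
          fun x hx => Finset.prod_le_prod (fun y hy => (hb X h0 hX x hx y hy).1.le)
            fun y hy => (hb X h0 hX x hx y hy).2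
    _ = _ := by
        simp only [Finset.prod_mul_distrib, Finset.prod_const, hN]
        rw [prod_prod_ite_lt_mul X fun x => (1 + |x|) ^ (2 * Real.logb q t), hN]

lemma thetaQ_pos (hq0 : 0 < q) (hq1 : q < 1) {v : ℝ} (hv : v < 0) : 0 < thetaQ q v :=
  mul_pos (qPochR_pos hq0 hq1 (by linarith))
    (qPochR_pos hq0 hq1 ((mul_neg_of_pos_of_neg hq0 (inv_lt_zero.2 hv)).trans one_pos))

lemma psiQ_pos (hq0 : 0 < q) (hq1 : q < 1) (ht0 : 0 < t) {u : ℝ} (hu : u < 0) :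
    0 < psiQ q t u :=
  div_pos (mul_pos (Real.rpow_pos_of_pos (neg_pos.2 hu) _)
    (thetaQ_pos hq0 hq1 (mul_neg_of_pos_of_neg ht0 hu)))
    (thetaQ_pos hq0 hq1 (mul_neg_of_pos_of_neg ht0 (inv_lt_zero.2 hu)))

lemma CNconst_pos (hq0 : 0 < q) (hq1 : q < 1) (ht0 : 0 < t) {ζp ζm : ℝ} (hζp : 0 < ζp)
    (hζm : ζm < 0) (N k : ℕ) : 0 < CNconst q t ζp ζm N k := by
  refine Finset.prod_pos fun i _ => Finset.prod_pos fun j _ => ?_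
  split_ifs
  · exact psiQ_pos hq0 hq1 ht0 (mul_neg_of_neg_of_pos
      (mul_neg_of_neg_of_pos hζm (inv_pos.2 hζp)) (zpow_pos ht0 _))
  · exact one_pos

end Interaction

section Weight

variable {q : ℝ} {b d : ℂ}

/-- The real form of `Wc` when `a`, `b` and `c`, `d` are conjugate pairs. -/
noncomputable def weightR (q : ℝ) (b d : ℂ) (x : ℝ) : ℝ :=
  (1 - q) * |x| * Complex.normSq (qPochC q (b * x)) / Complex.normSq (qPochC q (d * x))

lemma Wc_conj (hq0 : 0 < q) (hq1 : q < 1) (b d : ℂ) (x : ℝ) :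
    Wc q ((starRingEnd ℂ) b) b ((starRingEnd ℂ) d) d x = (weightR q b d x : ℂ) := by
  have e : ∀ z : ℂ, qPochC q ((starRingEnd ℂ) z * x) * qPochC q (z * x) =
      (Complex.normSq (qPochC q (z * x)) : ℂ) := fun z => by
    rw [Complex.normSq_eq_conj_mul_self, ← qPochC_conj hq0 hq1, map_mul, Complex.conj_ofReal]
  rw [Wc, weightR, e, e]
  push_cast
  ring

lemma normSq_qPochC_pos (hq0 : 0 < q) (hq1 : q < 1) (hb : b.im ≠ 0) {x : ℝ} (hx : x ≠ 0) :
    0 < Complex.normSq (qPochC q (b * x)) :=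
  Complex.normSq_pos.2 (qPochC_ne_zero hq0 hq1 (by simp [hb, hx]))

lemma weightR_pos (hq0 : 0 < q) (hq1 : q < 1) (hb : b.im ≠ 0) (hd : d.im ≠ 0) {x : ℝ}
    (hx : x ≠ 0) : 0 < weightR q b d x :=
  div_pos (mul_pos (mul_pos (sub_pos.2 hq1) (abs_pos.2 hx)) (normSq_qPochC_pos hq0 hq1 hb hx))
    (normSq_qPochC_pos hq0 hq1 hd hx)

/-- The weight dressed with the polynomial growth of the interaction. -/
noncomputable def dressedWeight (q s : ℝ) (k : ℕ) (b d : ℂ) (x : ℝ) : ℝ :=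
  ((1 + |x|) ^ s) ^ k * weightR q b d x

lemma dressedWeight_pos (hq0 : 0 < q) (hq1 : q < 1) (s : ℝ) (k : ℕ) (hb : b.im ≠ 0)
    (hd : d.im ≠ 0) {x : ℝ} (hx : x ≠ 0) : 0 < dressedWeight q s k b d x :=
  mul_pos (by positivity) (weightR_pos hq0 hq1 hb hd hx)

lemma dressedWeight_mul_div (hq0 : 0 < q) (hq1 : q < 1) (s : ℝ) (k : ℕ) (hb : b.im ≠ 0)
    (hd : d.im ≠ 0) {x : ℝ} (hx : x ≠ 0) :
    dressedWeight q s k b d (x * q) / dressedWeight q s k b d x =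
      q * (((1 + |x| * q) / (1 + |x|)) ^ s) ^ k *
        (Complex.normSq (1 - d * x) / Complex.normSq (1 - b * x)) := by
  have e : ∀ z : ℂ, Complex.normSq (qPochC q (z * x)) =
      Complex.normSq (1 - z * x) * Complex.normSq (qPochC q (z * (x * q : ℝ))) := fun z => by
    rw [qPochC_eq_mul hq0 hq1, map_mul, Complex.ofReal_mul, mul_assoc z]
  have p : ∀ z : ℂ, z.im ≠ 0 → Complex.normSq (1 - z * x) ≠ 0 := fun z hz h0 => by
    have := congrArg Complex.im (Complex.normSq_eq_zero.1 h0)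
    simp [hz, hx] at this
  have pb := p b hb
  have pd := p d hd
  have p1 := (normSq_qPochC_pos hq0 hq1 hb (mul_ne_zero hx hq0.ne')).ne'
  have p2 := (normSq_qPochC_pos hq0 hq1 hd (mul_ne_zero hx hq0.ne')).ne'
  have hx' : |x| ≠ 0 := abs_ne_zero.2 hx
  have h1q : 1 - q ≠ 0 := (sub_pos.2 hq1).ne'
  have hA : ((1 + |x|) ^ s) ^ k ≠ 0 := by positivity
  rw [Real.div_rpow (by positivity) (by positivity), div_pow]
  simp only [dressedWeight, weightR]
  rw [e b, e d, abs_mul, abs_of_pos hq0]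
  generalize Complex.normSq (qPochC q (b * (x * q : ℝ))) = B at p1 ⊢
  generalize Complex.normSq (qPochC q (d * (x * q : ℝ))) = D at p2 ⊢
  field_simp

lemma summable_dressedWeight (hq0 : 0 < q) (hq1 : q < 1) (s : ℝ) (k : ℕ) (hb : b.im ≠ 0)
    (hd : d.im ≠ 0) (h : Complex.normSq b < Complex.normSq d * (q * (q ^ s) ^ k)) {z : ℝ}
    (hz : z ≠ 0) : Summable fun n : ℤ => dressedWeight q s k b d (z * q ^ n) := by
  have hpow : Tendsto (fun n : ℕ => q ^ n) atTop (𝓝 0) :=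
    tendsto_pow_atTop_nhds_zero_of_lt_one hq0.le hq1
  have hb0 : Complex.normSq b ≠ 0 := by
    rw [Ne, Complex.normSq_eq_zero]; rintro rfl; simp at hb
  have hpos : ∀ n : ℤ, 0 < dressedWeight q s k b d (z * q ^ n) := fun n =>
    dressedWeight_pos hq0 hq1 s k hb hd (mul_ne_zero hz (zpow_ne_zero _ hq0.ne'))
  refine Summable.of_nat_of_neg_add_one ?_ ?_
  · refine summable_of_ratio_test_tendsto_lt_one hq1
      (Eventually.of_forall fun n => (hpos n).ne') ?_
    set r : ℝ → ℝ := fun x => q * (((1 + |x| * q) / (1 + |x|)) ^ s) ^ k *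
        (Complex.normSq (1 - d * x) / Complex.normSq (1 - b * x)) with hr
    have hcont : ContinuousAt r 0 := by
      have h1 : ContinuousAt (fun x : ℝ => ((1 + |x| * q) / (1 + |x|)) ^ s) 0 := by
        refine ContinuousAt.rpow_const (ContinuousAt.div (by fun_prop) (by fun_prop) (by simp)) ?_
        simp
      have h2 : ContinuousAt (fun x : ℝ => Complex.normSq (1 - d * x) /
          Complex.normSq (1 - b * x)) 0 :=
        ContinuousAt.div (Complex.continuous_normSq.continuousAt.comp (by fun_prop))
          (Complex.continuous_normSq.continuousAt.comp (by fun_prop)) (by simp)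
      exact (continuousAt_const.mul (h1.pow k)).mul h2
    have h0 : r 0 = q := by simp [hr]
    have ht : Tendsto (fun n : ℕ => z * q ^ n) atTop (𝓝 0) := by
      simpa using hpow.const_mul z
    have := hcont.tendsto.comp ht
    rw [h0] at this
    refine this.congr fun n => ?_
    rw [Real.norm_of_nonneg (hpos _).le, Real.norm_of_nonneg (hpos _).le, Function.comp_apply]
    have := dressedWeight_mul_div hq0 hq1 s k hb hd (mul_ne_zero hz (pow_ne_zero n hq0.ne'))
    simp only [hr]
    rw [← this, zpow_natCast, zpow_natCast, pow_succ, mul_assoc]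
  · set r : ℝ → ℝ := fun y => q * (((|y| + q) / (|y| + 1)) ^ s) ^ k *
        (Complex.normSq (y - d) / Complex.normSq (y - b)) with hr
    have hcont : ContinuousAt r 0 := by
      have h1 : ContinuousAt (fun y : ℝ => ((|y| + q) / (|y| + 1)) ^ s) 0 := by
        refine ContinuousAt.rpow_const (ContinuousAt.div (by fun_prop) (by fun_prop) (by simp)) ?_
        simp [hq0.ne']
      have h2 : ContinuousAt (fun y : ℝ => Complex.normSq (y - d) / Complex.normSq (y - b)) 0 :=
        ContinuousAt.div (Complex.continuous_normSq.continuousAt.comp (by fun_prop))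
          (Complex.continuous_normSq.continuousAt.comp (by fun_prop)) (by simpa using hb0)
      exact (continuousAt_const.mul (h1.pow k)).mul h2
    have h0 : r 0 = q * (q ^ s) ^ k * (Complex.normSq d / Complex.normSq b) := by simp [hr]
    have hbpos : 0 < Complex.normSq b := (Complex.normSq_nonneg b).lt_of_ne' hb0
    have hr0 : 1 < r 0 := by
      rw [h0, ← mul_div_assoc, one_lt_div hbpos]
      linarith
    refine summable_of_ratio_test_tendsto_lt_one (inv_lt_one_of_one_lt₀ hr0)
      (Eventually.of_forall fun n => (hpos _).ne') ?_
    have ht : Tendsto (fun n : ℕ => z⁻¹ * q ^ (n + 2)) atTop (𝓝 0) := by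
      simpa using (hpow.comp (tendsto_add_atTop_nat 2)).const_mul z⁻¹
    refine ((hcont.tendsto.comp ht).inv₀ (by positivity)).congr fun n => ?_
    have hx : z * q ^ (-((n + 1 : ℕ) + 1 : ℤ)) ≠ 0 := mul_ne_zero hz (zpow_ne_zero _ hq0.ne')
    set x := z * q ^ (-((n + 1 : ℕ) + 1 : ℤ)) with hxdef
    have hxq : z * q ^ (-((n : ℤ) + 1)) = x * q := by
      rw [hxdef, mul_assoc, ← zpow_add_one₀ hq0.ne']
      congr 2
    have hy : z⁻¹ * q ^ (n + 2) = x⁻¹ := by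
      rw [hxdef, mul_inv, zpow_neg, inv_inv]
      norm_cast
    rw [Real.norm_of_nonneg (hpos _).le, Real.norm_of_nonneg (hpos _).le, Function.comp_apply,
      ← hxdef, hxq, hy, ← inv_div, dressedWeight_mul_div hq0 hq1 s k hb hd hx, hr]
    have hxc : (x : ℂ) ≠ 0 := by exact_mod_cast hx
    have hxa : |x| ≠ 0 := abs_ne_zero.2 hx
    have e : ∀ w : ℂ, Complex.normSq (1 - w * x) =
        Complex.normSq x * Complex.normSq ((x⁻¹ : ℝ) - w) := fun w => by
      rw [← map_mul, mul_sub, Complex.ofReal_inv, mul_inv_cancel₀ hxc, mul_comm w]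
    have e1 : (|x⁻¹| + q) / (|x⁻¹| + 1) = (1 + |x| * q) / (1 + |x|) := by
      rw [abs_inv]; field_simp
    simp only
    rw [e1, e d, e b, mul_div_mul_left _ _ (by simpa using hx)]

end Weight

section Configurations

variable {q t ζp ζm : ℝ}

lemma chain_structure {ζ : ℝ} (S : Finset ℝ)
    (htop : ∀ x ∈ S, (∀ y ∈ S, y ≤ x) → ∃ n : ℤ, x = ζ * q ^ n)
    (hnext : ∀ x ∈ S, ∀ y ∈ S, y < x → (∀ z ∈ S, z ≤ y ∨ x ≤ z) → ∃ k : ℕ, y = x * t * q ^ k)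
    (hq0 : 0 < q) (y : ℝ) (hy : y ∈ S) :
    (∃ i : ℕ, i < S.card ∧ ∃ n : ℤ, y = ζ * t ^ i * q ^ n) ∧
      ∀ x ∈ S, y < x → ∃ m k : ℕ, y = x * t ^ (m + 1) * q ^ k := by
  suffices H : (∃ i : ℕ, i ≤ (S.filter (y < ·)).card ∧ ∃ n : ℤ, y = ζ * t ^ i * q ^ n) ∧
      ∀ x ∈ S, y < x → ∃ m k : ℕ, y = x * t ^ (m + 1) * q ^ k by
    obtain ⟨⟨i, hi, hn⟩, h2⟩ := H
    exact ⟨⟨i, hi.trans_lt (Finset.card_lt_card (Finset.filter_ssubset.2 ⟨y, hy, lt_irrefl y⟩)),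
      hn⟩, h2⟩
  induction hc : (S.filter (y < ·)).card using Nat.strong_induction_on generalizing y with
  | _ c ih =>
  rcases (S.filter (y < ·)).eq_empty_or_nonempty with he | hne
  · have hmax : ∀ x ∈ S, x ≤ y := fun x hx => by
      by_contra hlt
      have : x ∈ S.filter (y < ·) := Finset.mem_filter.2 ⟨hx, not_le.1 hlt⟩
      simp [he] at this
    obtain ⟨n, hn⟩ := htop y hy hmax
    exact ⟨⟨0, Nat.zero_le _, n, by simpa using hn⟩,
      fun x hx hlt => absurd (hmax x hx) (not_le.2 hlt)⟩
  · obtain ⟨w, hw, hmin⟩ := (S.filter (y < ·)).exists_min_image id hne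
    obtain ⟨hwS, hyw⟩ := Finset.mem_filter.1 hw
    have hgap : ∀ z ∈ S, z ≤ y ∨ w ≤ z := fun z hz => by
      rcases le_or_gt z y with h | h
      · exact Or.inl h
      · exact Or.inr (hmin z (Finset.mem_filter.2 ⟨hz, h⟩))
    have hcard : (S.filter (w < ·)).card < c := by
      rw [← hc]
      refine Finset.card_lt_card ((Finset.ssubset_iff_of_subset fun z hz => ?_).2
        ⟨w, hw, by simp⟩)
      rw [Finset.mem_filter] at hz ⊢
      exact ⟨hz.1, hyw.trans hz.2⟩
    obtain ⟨k, hk⟩ := hnext w hwS y hy hyw hgap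
    obtain ⟨⟨i, hi, n, hn⟩, hr⟩ := ih _ hcard w hwS rfl
    refine ⟨⟨i + 1, by omega, n + k, ?_⟩, fun x hx hyx => ?_⟩
    · rw [hk, hn, zpow_add₀ hq0.ne', zpow_natCast]; ring
    · rcases hgap x hx with h | h
      · exact absurd h (not_le.2 hyx)
      · rcases h.eq_or_lt with rfl | h
        · exact ⟨0, k, by rw [hk]; ring⟩
        · obtain ⟨m, l, hml⟩ := hr x hx h
          exact ⟨m + 1, l + k, by rw [hk, hml]; ring⟩

/-- The lattice supporting all `N`-particle configurations. -/
def configLattice (q t ζp ζm : ℝ) (N : ℕ) : Set ℝ :=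
  {x | ∃ i < N, ∃ n : ℤ, x = ζp * t ^ i * q ^ n ∨ x = ζm * t ^ i * q ^ n}

lemma OmegaN_structure (hq0 : 0 < q) {N : ℕ} {X : Finset ℝ} (hX : X ∈ OmegaN q t ζp ζm N) :
    (0 : ℝ) ∉ X ∧ RatioCond q t X ∧ ∀ x ∈ X, x ∈ configLattice q t ζp ζm N := by
  obtain ⟨hN, -, h0, -, -, hp, hm, hcp, hcm⟩ := hX
  simp only [Finset.mem_coe] at h0 hp hm hcp hcm
  have hP := chain_structure (ζ := ζp) (q := q) (t := t) (X.filter (0 < ·)) ?_ ?_ hq0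
  · have hM := chain_structure (ζ := -ζm) (q := q) (t := t)
      ((X.filter (· < 0)).image (fun x => -x)) ?_ ?_ hq0
    · have mp : ∀ {x : ℝ}, x ∈ X → 0 < x → x ∈ X.filter (0 < ·) := fun h h' =>
        Finset.mem_filter.2 ⟨h, h'⟩
      have mm : ∀ {x : ℝ}, x ∈ X → x < 0 → -x ∈ (X.filter (· < 0)).image (fun x => -x) :=
        fun h h' => Finset.mem_image_of_mem _ (Finset.mem_filter.2 ⟨h, h'⟩)
      refine ⟨h0, ⟨fun x hx y hy h1 h2 => (hP y (mp hy h1)).2 x (mp hx (h1.trans h2)) h2,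
        fun x hx y hy h1 h2 => ?_⟩, fun x hx => ?_⟩
      · obtain ⟨m, k, h⟩ := (hM _ (mm hx h2)).2 _ (mm hy (h1.trans h2)) (neg_lt_neg h1)
        exact ⟨m, k, by linarith⟩
      · rcases lt_or_gt_of_ne (fun e => h0 (e ▸ hx) : x ≠ 0) with h | h
        · obtain ⟨i, hi, n, hn⟩ := (hM _ (mm hx h)).1
          refine ⟨i, ?_, n, Or.inr (by linarith)⟩
          exact hN ▸ hi.trans_le (Finset.card_image_le.trans (Finset.card_filter_le _ _))
        · obtain ⟨i, hi, n, hn⟩ := (hP _ (mp hx h)).1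
          exact ⟨i, hN ▸ hi.trans_le (Finset.card_filter_le _ _), n, Or.inl hn⟩
    · simp only [Finset.forall_mem_image, Finset.mem_filter, and_imp]
      intro x hx hx0 hmax
      obtain ⟨n, hn⟩ := hm x hx hx0 fun y hy hy0 => neg_le_neg_iff.1 (hmax hy hy0)
      exact ⟨n, by rw [hn]; ring⟩
    · simp only [Finset.forall_mem_image, Finset.mem_filter, and_imp]
      intro x hx hx0 y hy hy0 hlt hgap
      obtain ⟨k, hk⟩ := hcm y hy x hx (neg_lt_neg_iff.1 hlt) hy0 fun z hz => by
        rcases lt_or_ge z 0 with h | h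
        · exact (hgap hz h).symm.imp neg_le_neg_iff.1 neg_le_neg_iff.1
        · exact Or.inr (hy0.le.trans h)
      exact ⟨k, by rw [hk]; ring⟩
  · simp only [Finset.mem_filter, and_imp]
    exact fun x hx hx0 hmax => hp x hx hx0 hmax
  · simp only [Finset.mem_filter, and_imp]
    intro x hx hx0 y hy hy0 hlt hgap
    refine hcp x hx y hy hy0 hlt fun z hz => ?_
    rcases lt_or_ge 0 z with h | h
    · exact hgap z hz h
    · exact Or.inl (h.trans hy0.le)

lemma OmegaN_nonempty (ht0 : 0 < t) (ht1 : t < 1) (hζp : 0 < ζp) (N : ℕ) :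
    (OmegaN q t ζp ζm N).Nonempty := by
  have hanti : StrictAnti fun i : ℕ => ζp * t ^ i := fun i j hij =>
    mul_lt_mul_of_pos_left (pow_lt_pow_right_of_lt_one₀ ht0 ht1 hij) hζp
  have hpos : ∀ i : ℕ, 0 < ζp * t ^ i := fun i => by positivity
  refine ⟨(Finset.range N).image fun i => ζp * t ^ i, ?_, ?_⟩
  · rw [Finset.card_image_of_injective _ hanti.injective, Finset.card_range]
  have hfin := ((Finset.range N).image fun i => ζp * t ^ i).finite_toSet
  refine ⟨hfin.countable, ?_, fun x _ _ => hfin.subset fun y hy => hy.1,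
    fun x _ _ => hfin.subset fun y hy => hy.1, ?_⟩
  · simp [hζp.ne', ht0.ne']
  simp only [Finset.mem_coe, Finset.forall_mem_image, Finset.mem_range]
  refine ⟨fun i hi _ hmax => ⟨0, ?_⟩, fun i _ h => absurd h (hpos i).not_gt,
    fun i hi j hj _ hlt hgap => ⟨0, ?_⟩, fun i _ j _ _ h => absurd h (hpos i).not_gt⟩
  · have : i = 0 := Nat.le_zero.1 (hanti.le_iff_ge.1 (hmax (x := 0) (by omega) (hpos 0)))
    simp [this]
  · have hij : i < j := hanti.lt_iff_gt.1 hlt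
    rcases hgap (x := i + 1) (by omega) with h | h
    · have h1 : j ≤ i + 1 := hanti.le_iff_ge.1 h
      obtain rfl : j = i + 1 := by omega
      rw [pow_succ]; ring
    · have h1 : i + 1 ≤ i := hanti.le_iff_ge.1 h
      omega

lemma summable_indicator_configLattice (hq0 : 0 < q) (hq1 : q < 1) (ht0 : 0 < t)
    (hζp : ζp ≠ 0) (hζm : ζm ≠ 0) (N : ℕ) {F : ℝ → ℝ} (hF0 : ∀ x, x ≠ 0 → 0 ≤ F x)
    (hF : ∀ z, z ≠ 0 → Summable fun n : ℤ => F (z * q ^ n)) :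
    Summable ((configLattice q t ζp ζm N).indicator F) := by
  have hR : ∀ z, z ≠ 0 → Summable ((Set.range fun n : ℤ => z * q ^ n).indicator F) := by
    intro z hz
    have hinj : Function.Injective fun n : ℤ => z * q ^ n := fun m n hmn =>
      (zpow_right_injective₀ hq0 hq1.ne) (mul_left_cancel₀ hz hmn)
    refine (hinj.summable_iff fun x hx => Set.indicator_of_notMem hx F).1 ((hF z hz).congr ?_)
    intro n
    exact (Set.indicator_of_mem (Set.mem_range_self (f := fun n : ℤ => z * q ^ n) n) F).symm
  have hnn : ∀ z, z ≠ 0 → ∀ x, 0 ≤ (Set.range fun n : ℤ => z * q ^ n).indicator F x := by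
    intro z hz x
    refine Set.indicator_apply_nonneg ?_
    rintro ⟨n, rfl⟩
    exact hF0 _ (mul_ne_zero hz (zpow_ne_zero _ hq0.ne'))
  have hne : ∀ ζ : ℝ, ζ ≠ 0 → ∀ i : ℕ, ζ * t ^ i ≠ 0 := fun ζ hζ i =>
    mul_ne_zero hζ (pow_ne_zero i ht0.ne')
  have hnn' : ∀ x, ∀ i ∈ Finset.range N,
      0 ≤ (Set.range fun n : ℤ => ζp * t ^ i * q ^ n).indicator F x +
        (Set.range fun n : ℤ => ζm * t ^ i * q ^ n).indicator F x := fun x i _ =>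
    add_nonneg (hnn _ (hne _ hζp i) x) (hnn _ (hne _ hζm i) x)
  refine Summable.of_nonneg_of_le (fun x => ?_) (fun x => ?_) (summable_sum (s := Finset.range N)
    fun i _ => (hR _ (hne _ hζp i)).add (hR _ (hne _ hζm i)))
  · refine Set.indicator_apply_nonneg ?_
    rintro ⟨i, -, n, rfl | rfl⟩
    · exact hF0 _ (mul_ne_zero (hne _ hζp i) (zpow_ne_zero _ hq0.ne'))
    · exact hF0 _ (mul_ne_zero (hne _ hζm i) (zpow_ne_zero _ hq0.ne'))
  · by_cases hx : x ∈ configLattice q t ζp ζm N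
    · rw [Set.indicator_of_mem hx]
      obtain ⟨i, hi, n, hn⟩ := hx
      refine le_trans ?_ (Finset.single_le_sum (hnn' x) (Finset.mem_range.2 hi))
      rcases hn with hn | hn
      · exact le_add_of_le_of_nonneg (Set.indicator_of_mem (Set.mem_range.2 ⟨n, hn.symm⟩) F).ge
          (hnn _ (hne _ hζm i) x)
      · exact le_add_of_nonneg_of_le (hnn _ (hne _ hζp i) x)
          (Set.indicator_of_mem (Set.mem_range.2 ⟨n, hn.symm⟩) F).ge
    · rw [Set.indicator_of_notMem hx]
      exact Finset.sum_nonneg (hnn' x)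

end Configurations

/-- Principal series, N particles: if `c = conj d ∈ ℂ∖ℝ`, `a = conj b ∈ ℂ∖ℝ` and
`ab < cd q^{2τ(N-1)+1}` (both products positive reals), the unnormalized weights
`M̃_N(X)` are strictly positive reals, summable with strictly positive sum `Z_N`, and
the normalized weights form a probability distribution on `Ω_N` with strictly positive
weights. -/
theorem stmt10 (q t ζp ζm : ℝ) (hq0 : 0 < q) (hq1 : q < 1) (ht0 : 0 < t) (ht1 : t < 1)
    (hζp : 0 < ζp) (hζm : ζm < 0) (N : ℕ) (hN : 1 ≤ N)
    (a b c d : ℂ) (hab : a = (starRingEnd ℂ) b) (ha : a.im ≠ 0)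
    (hcd : c = (starRingEnd ℂ) d) (hc : c.im ≠ 0)
    (h : (a * b).re < (c * d).re * q ^ (2 * Real.logb q t * ((N : ℝ) - 1) + 1)) :
    (∀ X ∈ OmegaN q t ζp ζm N,
      0 < (Mtilde q t ζp ζm N a b c d X).re ∧ (Mtilde q t ζp ζm N a b c d X).im = 0) ∧
    Summable (fun X : OmegaN q t ζp ζm N => (Mtilde q t ζp ζm N a b c d (X : Finset ℝ)).re) ∧
    0 < (∑' X : OmegaN q t ζp ζm N, (Mtilde q t ζp ζm N a b c d (X : Finset ℝ)).re) ∧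
    ∑' X : OmegaN q t ζp ζm N,
      (Mtilde q t ζp ζm N a b c d (X : Finset ℝ)).re /
        (∑' Y : OmegaN q t ζp ζm N, (Mtilde q t ζp ζm N a b c d (Y : Finset ℝ)).re) = 1 := by
  subst hab hcd
  have hb : b.im ≠ 0 := by simpa using ha
  have hd : d.im ≠ 0 := by simpa using hc
  have hM : ∀ X : Finset ℝ,
      Mtilde q t ζp ζm N ((starRingEnd ℂ) b) b ((starRingEnd ℂ) d) d X =
        ((CNconst q t ζp ζm N (X.filter (fun x => 0 < x)).card * Vqt q t X *
          ∏ x ∈ X, weightR q b d x : ℝ) : ℂ) := fun X => by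
    simp only [Mtilde, Wc_conj hq0 hq1]
    push_cast
    rfl
  simp only [hM, Complex.ofReal_re, Complex.ofReal_im, and_true]
  obtain ⟨K, hK, hV⟩ := exists_Vqt_bounds hq0 hq1 ht0 ht1 N
  set s := 2 * Real.logb q t with hs
  have hcrit : Complex.normSq b < Complex.normSq d * (q * (q ^ s) ^ (N - 1)) := by
    have e : q ^ (s * ((N : ℝ) - 1) + 1) = q * (q ^ s) ^ (N - 1) := by
      rw [Real.rpow_add_one hq0.ne', Real.rpow_mul hq0.le, mul_comm, ← Real.rpow_natCast,
        Nat.cast_pred hN]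
    rw [e, ← Complex.normSq_eq_conj_mul_self, ← Complex.normSq_eq_conj_mul_self,
      Complex.ofReal_re, Complex.ofReal_re] at h
    exact h
  have hC : ∀ k, 0 < CNconst q t ζp ζm N k := CNconst_pos hq0 hq1 ht0 hζp hζm N
  have hne : ∀ X ∈ OmegaN q t ζp ζm N, ∀ x ∈ X, x ≠ 0 := fun X hX x hx e =>
    (OmegaN_structure hq0 hX).1 (e ▸ hx)
  have hW : ∀ X ∈ OmegaN q t ζp ζm N, ∀ x ∈ X, 0 < weightR q b d x := fun X hX x hx =>
    weightR_pos hq0 hq1 hb hd (hne X hX x hx)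
  have hpos : ∀ X ∈ OmegaN q t ζp ζm N,
      0 < CNconst q t ζp ζm N (X.filter (fun x => 0 < x)).card * Vqt q t X *
        ∏ x ∈ X, weightR q b d x := fun X hX => by
    obtain ⟨h0, hr, -⟩ := OmegaN_structure hq0 hX
    exact mul_pos (mul_pos (hC _) (hV X hX.1 h0 hr).1) (Finset.prod_pos (hW X hX))
  have hsum : Summable fun X : OmegaN q t ζp ζm N =>
      CNconst q t ζp ζm N ((X : Finset ℝ).filter (fun x => 0 < x)).card * Vqt q t X *
        ∏ x ∈ (X : Finset ℝ), weightR q b d x := by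
    set L := configLattice q t ζp ζm N with hL
    set F := dressedWeight q s (N - 1) b d with hFdef
    have hF0 : ∀ x, x ≠ 0 → 0 ≤ F x := fun x hx =>
      (dressedWeight_pos hq0 hq1 s (N - 1) hb hd hx).le
    have hind := summable_indicator_configLattice hq0 hq1 ht0 hζp.ne' hζm.ne N hF0
      fun z hz => summable_dressedWeight hq0 hq1 s (N - 1) hb hd hcrit hz
    have hind0 : ∀ x, 0 ≤ L.indicator F x := fun x => by
      refine Set.indicator_apply_nonneg fun hx => hF0 x ?_
      obtain ⟨i, -, n, rfl | rfl⟩ := hx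
      · exact mul_ne_zero (mul_ne_zero hζp.ne' (pow_ne_zero i ht0.ne')) (zpow_ne_zero _ hq0.ne')
      · exact mul_ne_zero (mul_ne_zero hζm.ne (pow_ne_zero i ht0.ne')) (zpow_ne_zero _ hq0.ne')
    have hprod := ((summable_finsetProd_of_summable_nonneg hind0 hind).comp_injective
      (Subtype.val_injective (p := fun X => X ∈ OmegaN q t ζp ζm N))).mul_left
      ((∑ k ∈ Finset.range (N + 1), CNconst q t ζp ζm N k) * K)
    refine Summable.of_nonneg_of_le (fun X => (hpos X X.2).le) (fun X => ?_) hprod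
    obtain ⟨X, hX⟩ := X
    obtain ⟨h0, hr, hLX⟩ := OmegaN_structure hq0 hX
    obtain ⟨hV0, hVK⟩ := hV X hX.1 h0 hr
    have hCk : CNconst q t ζp ζm N (X.filter (fun x => 0 < x)).card ≤
        ∑ k ∈ Finset.range (N + 1), CNconst q t ζp ζm N k :=
      Finset.single_le_sum (fun k _ => (hC k).le) (Finset.mem_range.2
        (Nat.lt_succ_of_le (hX.1 ▸ Finset.card_filter_le _ _)))
    have hsplit : ∏ x ∈ X, L.indicator F x =
        (∏ x ∈ X, ((1 + |x|) ^ s) ^ (N - 1)) * ∏ x ∈ X, weightR q b d x := by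
      rw [← Finset.prod_mul_distrib]
      exact Finset.prod_congr rfl fun x hx => Set.indicator_of_mem (hLX x hx) F
    have hWX : 0 ≤ ∏ x ∈ X, weightR q b d x := (Finset.prod_pos (hW X hX)).le
    simp only [Function.comp_apply]
    rw [hsplit, ← mul_assoc]
    refine mul_le_mul_of_nonneg_right ?_ hWX
    rw [mul_assoc]
    exact mul_le_mul hCk hVK hV0.le ((hC _).le.trans hCk)
  obtain ⟨X₀, hX₀⟩ := OmegaN_nonempty (q := q) (ζm := ζm) ht0 ht1 hζp N
  have hZ := hsum.tsum_pos (fun X => (hpos X X.2).le) ⟨X₀, hX₀⟩ (hpos X₀ hX₀)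
  exact ⟨hpos, hsum, hZ, by rw [tsum_div_const, div_self hZ.ne']⟩
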